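/- (Uniform safe step size) Let ε ∈ (0, 3/4), λ > 0, L' > 0, and define γ_s := min{ λ(1−ε)ε / ((1+ε)²(L')² + λ²(1+ε)ε²), √(ε / (2(1+ε)²(L')²)), 1/(2λ) }. Let X ∈ St(p,n)^ε and g ∈ ℝ^{n×p} with ‖g‖_F ≤ L'. Then for every step size γ with 0 ≤ γ ≤ γ_s, the point X̃ := X − γΛ̃(X;g) satisfies X̃ ∈ St(p,n)^ε. -/

import Mathlib

open Matrix Finset

noncomputable section

/-- Frobenius inner product `⟨A, B⟩ = Tr (Aᵀ * B)`. -/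
def finner {n p : ℕ} (A B : Matrix (Fin n) (Fin p) ℝ) : ℝ :=
  (Aᵀ * B).trace

/-- Frobenius norm `‖A‖_F = √(Tr (Aᵀ * A))`. -/
def fnorm {n p : ℕ} (A : Matrix (Fin n) (Fin p) ℝ) : ℝ :=
  Real.sqrt ((Aᵀ * A).trace)

/-- Skew-symmetric part `skew M = (M - Mᵀ)/2`. -/
def skewPart {m : ℕ} (M : Matrix (Fin m) (Fin m) ℝ) : Matrix (Fin m) (Fin m) ℝ :=
  (1 / 2 : ℝ) • (M - Mᵀ)

/-- Symmetric part `sym M = (M + Mᵀ)/2`. -/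
def symPart {m : ℕ} (M : Matrix (Fin m) (Fin m) ℝ) : Matrix (Fin m) (Fin m) ℝ :=
  (1 / 2 : ℝ) • (M + Mᵀ)

/-- Penalty function `N(X) = ‖XᵀX - I‖_F² / 4`. -/
def penaltyN {n p : ℕ} (X : Matrix (Fin n) (Fin p) ℝ) : ℝ :=
  (1 / 4 : ℝ) * fnorm (Xᵀ * X - 1) ^ 2

/-- Landing direction `Λ̃(X; g) = skew(g Xᵀ) X + λ X (XᵀX - I)` with gradient estimate `g`. -/
def landingDir {n p : ℕ} (lam : ℝ) (X g : Matrix (Fin n) (Fin p) ℝ) :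
    Matrix (Fin n) (Fin p) ℝ :=
  skewPart (g * Xᵀ) * X + lam • (X * (Xᵀ * X - 1))

section Frobenius

attribute [local instance] Matrix.frobeniusNormedAddCommGroup Matrix.frobeniusNormedSpace

theorem finner_eq_sum {n p : ℕ} (A B : Matrix (Fin n) (Fin p) ℝ) :
    finner A B = ∑ x : Fin p × Fin n, A x.2 x.1 * B x.2 x.1 := by
  simp [finner, Matrix.trace, Matrix.mul_apply, Fintype.sum_prod_type]

theorem fnorm_sq {n p : ℕ} (A : Matrix (Fin n) (Fin p) ℝ) : fnorm A ^ 2 = finner A A := by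
  refine Real.sq_sqrt ?_
  change 0 ≤ finner A A
  rw [finner_eq_sum]
  exact Finset.sum_nonneg fun _ _ => mul_self_nonneg _

theorem fnorm_nonneg {n p : ℕ} (A : Matrix (Fin n) (Fin p) ℝ) : 0 ≤ fnorm A :=
  Real.sqrt_nonneg _

theorem fnorm_eq_norm {n p : ℕ} (A : Matrix (Fin n) (Fin p) ℝ) : fnorm A = ‖A‖ := by
  rw [Matrix.frobenius_norm_def, ← Real.sqrt_eq_rpow]
  change √(finner A A) = _
  rw [finner_eq_sum, Fintype.sum_prod_type_right]
  simp [sq]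

theorem fnorm_add_le {n p : ℕ} (A B : Matrix (Fin n) (Fin p) ℝ) :
    fnorm (A + B) ≤ fnorm A + fnorm B := by
  simpa only [fnorm_eq_norm] using norm_add_le A B

theorem fnorm_sub_le {n p : ℕ} (A B : Matrix (Fin n) (Fin p) ℝ) :
    fnorm (A - B) ≤ fnorm A + fnorm B := by
  simpa only [fnorm_eq_norm] using norm_sub_le A B

theorem fnorm_smul {n p : ℕ} (c : ℝ) (A : Matrix (Fin n) (Fin p) ℝ) :
    fnorm (c • A) = |c| * fnorm A := by
  simpa only [fnorm_eq_norm, Real.norm_eq_abs] using norm_smul c A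

theorem fnorm_mul_le {m n p : ℕ} (A : Matrix (Fin m) (Fin n) ℝ) (B : Matrix (Fin n) (Fin p) ℝ) :
    fnorm (A * B) ≤ fnorm A * fnorm B := by
  simpa only [fnorm_eq_norm] using Matrix.frobenius_norm_mul A B

theorem fnorm_transpose {n p : ℕ} (A : Matrix (Fin n) (Fin p) ℝ) : fnorm Aᵀ = fnorm A := by
  simpa only [fnorm_eq_norm] using Matrix.frobenius_norm_transpose A

end Frobenius

theorem finner_le_fnorm_mul_fnorm {n p : ℕ} (A B : Matrix (Fin n) (Fin p) ℝ) :
    finner A B ≤ fnorm A * fnorm B := by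
  refine abs_le_of_sq_le_sq' ?_ (mul_nonneg (fnorm_nonneg A) (fnorm_nonneg B)) |>.2
  rw [mul_pow, fnorm_sq, fnorm_sq]
  simp only [finner_eq_sum, ← sq]
  exact Finset.sum_mul_sq_le_sq_mul_sq _ _ _

theorem fnorm_mul_sq_le {n p q : ℕ} (X : Matrix (Fin n) (Fin p) ℝ) (M : Matrix (Fin p) (Fin q) ℝ) :
    fnorm (X * M) ^ 2 ≤ (1 + fnorm (Xᵀ * X - 1)) * fnorm M ^ 2 := by
  have h : finner (X * M) (X * M) = finner M M + finner M ((Xᵀ * X - 1) * M) := by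
    simp only [finner, ← Matrix.trace_add]
    congr 1
    simp only [Matrix.transpose_mul, Matrix.sub_mul, Matrix.mul_sub, Matrix.one_mul,
      Matrix.mul_assoc]
    abel
  have h₁ := finner_le_fnorm_mul_fnorm M ((Xᵀ * X - 1) * M)
  have h₂ := mul_le_mul_of_nonneg_left (fnorm_mul_le (Xᵀ * X - 1) M) (fnorm_nonneg M)
  rw [fnorm_sq, h, ← fnorm_sq]
  linarith

theorem fnorm_transpose_mul_sq_le {n p q : ℕ} (X : Matrix (Fin n) (Fin p) ℝ)
    (M : Matrix (Fin n) (Fin q) ℝ) :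
    fnorm (Xᵀ * M) ^ 2 ≤ (1 + fnorm (Xᵀ * X - 1)) * fnorm M ^ 2 := by
  have h : finner (Xᵀ * M) (Xᵀ * M) = finner M (X * (Xᵀ * M)) := by
    simp only [finner, Matrix.transpose_mul, Matrix.transpose_transpose, Matrix.mul_assoc]
  have h₁ := finner_le_fnorm_mul_fnorm M (X * (Xᵀ * M))
  rw [← h, ← fnorm_sq] at h₁
  have h₂ := fnorm_mul_sq_le X (Xᵀ * M)
  have h₃ : (fnorm (Xᵀ * M) ^ 2) ^ 2 ≤
      (1 + fnorm (Xᵀ * X - 1)) * fnorm M ^ 2 * fnorm (Xᵀ * M) ^ 2 := by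
    calc (fnorm (Xᵀ * M) ^ 2) ^ 2 ≤ (fnorm M * fnorm (X * (Xᵀ * M))) ^ 2 :=
          pow_le_pow_left₀ (sq_nonneg _) h₁ 2
      _ = fnorm M ^ 2 * fnorm (X * (Xᵀ * M)) ^ 2 := mul_pow _ _ _
      _ ≤ fnorm M ^ 2 * ((1 + fnorm (Xᵀ * X - 1)) * fnorm (Xᵀ * M) ^ 2) :=
          mul_le_mul_of_nonneg_left h₂ (sq_nonneg _)
      _ = _ := by ring
  rcases (sq_nonneg (fnorm (Xᵀ * M))).eq_or_lt with h₀ | h₀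
  · rw [← h₀]
    exact mul_nonneg (by linarith [fnorm_nonneg (Xᵀ * X - 1)]) (sq_nonneg _)
  · rw [sq (fnorm (Xᵀ * M) ^ 2)] at h₃
    exact le_of_mul_le_mul_right h₃ h₀

theorem fnorm_skewPart_le {m : ℕ} (M : Matrix (Fin m) (Fin m) ℝ) :
    fnorm (skewPart M) ≤ fnorm M := by
  have h := fnorm_sub_le M Mᵀ
  rw [fnorm_transpose] at h
  rw [skewPart, fnorm_smul, abs_of_pos (by norm_num)]
  linarith

theorem transpose_skewPart {m : ℕ} (M : Matrix (Fin m) (Fin m) ℝ) :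
    (skewPart M)ᵀ = -skewPart M := by
  simp [skewPart, ← smul_neg]

theorem fnorm_skewPart_mul_sq_le {n p : ℕ} (X g : Matrix (Fin n) (Fin p) ℝ) :
    fnorm (skewPart (g * Xᵀ) * X) ^ 2 ≤ (1 + fnorm (Xᵀ * X - 1)) ^ 2 * fnorm g ^ 2 := by
  have h₁ := fnorm_transpose_mul_sq_le X (skewPart (g * Xᵀ))ᵀ
  rw [← Matrix.transpose_mul, fnorm_transpose, fnorm_transpose] at h₁
  have h₂ := pow_le_pow_left₀ (fnorm_nonneg _) (fnorm_skewPart_le (g * Xᵀ)) 2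
  have h₃ := fnorm_mul_sq_le X gᵀ
  rw [← fnorm_transpose (X * gᵀ), Matrix.transpose_mul, Matrix.transpose_transpose,
    fnorm_transpose] at h₃
  calc _ ≤ _ := h₁
    _ ≤ (1 + fnorm (Xᵀ * X - 1)) * ((1 + fnorm (Xᵀ * X - 1)) * fnorm g ^ 2) :=
        mul_le_mul_of_nonneg_left (h₂.trans h₃) (by linarith [fnorm_nonneg (Xᵀ * X - 1)])
    _ = _ := by ring

theorem fnorm_add_sq_of_finner_eq_zero {n p : ℕ} {A B : Matrix (Fin n) (Fin p) ℝ}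
    (h : finner A B = 0) : fnorm (A + B) ^ 2 = fnorm A ^ 2 + fnorm B ^ 2 := by
  simp only [fnorm_sq, finner_eq_sum] at h ⊢
  simp only [Matrix.add_apply, add_mul, mul_add, Finset.sum_add_distrib]
  have h' : ∑ x : Fin p × Fin n, B x.2 x.1 * A x.2 x.1 = 0 := by simpa only [mul_comm] using h
  rw [h, h']
  ring

/-- A skew-symmetric and a symmetric matrix are orthogonal for the Frobenius inner product. -/
theorem trace_mul_eq_zero_of_skew_of_symm {m : ℕ} {K D : Matrix (Fin m) (Fin m) ℝ}
    (hK : Kᵀ = -K) (hD : Dᵀ = D) : (K * D).trace = 0 := by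
  have h := Matrix.trace_transpose (K * D)
  rw [Matrix.transpose_mul, hK, hD, Matrix.mul_neg, Matrix.trace_neg, Matrix.trace_mul_comm] at h
  linarith

theorem transpose_gram_sub_one {n p : ℕ} (X : Matrix (Fin n) (Fin p) ℝ) :
    (Xᵀ * X - 1)ᵀ = Xᵀ * X - 1 := by
  simp

theorem fnorm_landingDir_sq {n p : ℕ} (lam : ℝ) (X g : Matrix (Fin n) (Fin p) ℝ) :
    fnorm (landingDir lam X g) ^ 2 =
      fnorm (skewPart (g * Xᵀ) * X) ^ 2 + lam ^ 2 * fnorm (X * (Xᵀ * X - 1)) ^ 2 := by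
  have hK : (Xᵀ * skewPart (g * Xᵀ) * X)ᵀ = -(Xᵀ * skewPart (g * Xᵀ) * X) := by
    simp only [Matrix.transpose_mul, Matrix.transpose_transpose, transpose_skewPart,
      Matrix.neg_mul, Matrix.mul_neg, Matrix.mul_assoc]
  have h := trace_mul_eq_zero_of_skew_of_symm hK (transpose_gram_sub_one X)
  rw [landingDir, fnorm_add_sq_of_finner_eq_zero, fnorm_smul, mul_pow, sq_abs]
  rw [finner, Matrix.transpose_mul, transpose_skewPart, Matrix.mul_smul, Matrix.trace_smul,
    Matrix.mul_neg, Matrix.neg_mul, Matrix.trace_neg, ← Matrix.mul_assoc, h]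
  simp

theorem gram_sub_smul_landingDir {n p : ℕ} (lam γ : ℝ) (X g : Matrix (Fin n) (Fin p) ℝ) :
    (X - γ • landingDir lam X g)ᵀ * (X - γ • landingDir lam X g) - 1 =
      (1 - 2 * γ * lam) • (Xᵀ * X - 1) - (2 * γ * lam) • ((Xᵀ * X - 1) * (Xᵀ * X - 1)) +
        γ ^ 2 • ((landingDir lam X g)ᵀ * landingDir lam X g) := by
  have h : Xᵀ * landingDir lam X g + (landingDir lam X g)ᵀ * X =
      (2 * lam) • ((Xᵀ * X - 1) + (Xᵀ * X - 1) * (Xᵀ * X - 1)) := by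
    have hXX : Xᵀ * X = (Xᵀ * X - 1) + 1 := by abel
    have hD := transpose_gram_sub_one X
    rw [landingDir]
    generalize Xᵀ * X - 1 = D at hXX hD ⊢
    simp only [Matrix.transpose_add, Matrix.transpose_smul, Matrix.transpose_mul,
      transpose_skewPart, hD, Matrix.mul_add, Matrix.add_mul, Matrix.mul_smul, Matrix.smul_mul,
      Matrix.mul_neg, Matrix.neg_mul, Matrix.mul_assoc, hXX, Matrix.mul_one]
    simp only [← Matrix.mul_assoc Xᵀ X, hXX, Matrix.add_mul, Matrix.one_mul]
    module
  generalize landingDir lam X g = L at h ⊢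
  have h' : (X - γ • L)ᵀ * (X - γ • L) =
      Xᵀ * X - γ • (Xᵀ * L + Lᵀ * X) + γ ^ 2 • (Lᵀ * L) := by
    simp only [Matrix.transpose_sub, Matrix.transpose_smul, Matrix.sub_mul, Matrix.mul_sub,
      Matrix.mul_smul, Matrix.smul_mul]
    module
  rw [h', h]
  module

theorem fnorm_landingDir_sq_le {n p : ℕ} (lam : ℝ) (X g : Matrix (Fin n) (Fin p) ℝ) :
    fnorm (landingDir lam X g) ^ 2 ≤ (1 + fnorm (Xᵀ * X - 1)) ^ 2 * fnorm g ^ 2 +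
      lam ^ 2 * (1 + fnorm (Xᵀ * X - 1)) * fnorm (Xᵀ * X - 1) ^ 2 := by
  rw [fnorm_landingDir_sq, mul_assoc (lam ^ 2)]
  exact add_le_add (fnorm_skewPart_mul_sq_le X g)
    (mul_le_mul_of_nonneg_left (fnorm_mul_sq_le X _) (sq_nonneg lam))

theorem fnorm_gram_sub_smul_landingDir_le {n p : ℕ} {lam γ : ℝ} (hlam : 0 ≤ lam) (hγ : 0 ≤ γ)
    (hγlam : 2 * γ * lam ≤ 1) (X g : Matrix (Fin n) (Fin p) ℝ) :
    fnorm ((X - γ • landingDir lam X g)ᵀ * (X - γ • landingDir lam X g) - 1) ≤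
      (1 - 2 * γ * lam) * fnorm (Xᵀ * X - 1) + 2 * γ * lam * fnorm (Xᵀ * X - 1) ^ 2 +
        γ ^ 2 * fnorm (landingDir lam X g) ^ 2 := by
  rw [gram_sub_smul_landingDir]
  refine (fnorm_add_le _ _).trans (add_le_add ((fnorm_sub_le _ _).trans (add_le_add ?_ ?_)) ?_)
  · rw [fnorm_smul, abs_of_nonneg (by linarith)]
  · rw [fnorm_smul, abs_of_nonneg (by positivity), sq]
    exact mul_le_mul_of_nonneg_left (fnorm_mul_le _ _) (by positivity)
  · rw [fnorm_smul, abs_of_nonneg (sq_nonneg γ), sq (fnorm _)]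
    refine mul_le_mul_of_nonneg_left ((fnorm_mul_le _ _).trans ?_) (sq_nonneg γ)
    rw [fnorm_transpose]

/-- uniform safe step size: if `X ∈ St(p,n)^ε`, `‖g‖_F ≤ L'` and
`0 ≤ γ ≤ γ_s`, then `X - γ Λ̃(X;g)` stays in the safe region. -/
theorem uniform_safe_step_size {n p : ℕ} (ε lam L' γ : ℝ)
    (hε : ε ∈ Set.Ioo (0 : ℝ) (3 / 4)) (hlam : 0 < lam) (hL' : 0 < L')
    (X g : Matrix (Fin n) (Fin p) ℝ)
    (hX : fnorm (Xᵀ * X - 1) ≤ ε) (hg : fnorm g ≤ L')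
    (hγ0 : 0 ≤ γ)
    (hγ : γ ≤ min (lam * (1 - ε) * ε / ((1 + ε) ^ 2 * L' ^ 2 + lam ^ 2 * (1 + ε) * ε ^ 2))
      (min (Real.sqrt (ε / (2 * (1 + ε) ^ 2 * L' ^ 2))) (1 / (2 * lam)))) :
    fnorm ((X - γ • landingDir lam X g)ᵀ * (X - γ • landingDir lam X g) - 1) ≤ ε := by
  obtain ⟨hε0, -⟩ := hε
  obtain ⟨hγ₁, hγ'⟩ := le_min_iff.1 hγ
  have hγlam : 2 * γ * lam ≤ 1 := by
    have h := (le_div_iff₀ (by positivity)).1 (le_min_iff.1 hγ').2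
    linarith
  rw [le_div_iff₀ (by positivity)] at hγ₁
  refine (fnorm_gram_sub_smul_landingDir_le hlam.le hγ0 hγlam X g).trans ?_
  have hL := fnorm_landingDir_sq_le lam X g
  have hd := fnorm_nonneg (Xᵀ * X - 1)
  have hg0 := fnorm_nonneg g
  generalize fnorm (Xᵀ * X - 1) = d at *
  have hbound : fnorm (landingDir lam X g) ^ 2 ≤
      (1 + ε) ^ 2 * L' ^ 2 + lam ^ 2 * (1 + ε) * ε ^ 2 := hL.trans (by gcongr)
  have hc : 0 ≤ 1 - 2 * γ * lam := by linarith
  calc _ ≤ (1 - 2 * γ * lam) * ε + 2 * γ * lam * ε ^ 2 +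
        γ ^ 2 * ((1 + ε) ^ 2 * L' ^ 2 + lam ^ 2 * (1 + ε) * ε ^ 2) := by gcongr
    _ = ε - γ * (2 * (lam * (1 - ε) * ε) -
        γ * ((1 + ε) ^ 2 * L' ^ 2 + lam ^ 2 * (1 + ε) * ε ^ 2)) := by ring
    _ ≤ ε := by
        refine sub_le_self _ (mul_nonneg hγ0 ?_)
        have : 0 ≤ γ * ((1 + ε) ^ 2 * L' ^ 2 + lam ^ 2 * (1 + ε) * ε ^ 2) := by positivity
        linarith
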